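/- For every r ≥ 4, let O_r be the octahedron graph (cocktail party graph) obtained from K_{2r} on vertex set Fin (2r) by deleting the perfect matching of antipodal edges {i, i+r}, 0 ≤ i ≤ r−1. Then any partition of the edge set of O_r (with the vertices in this circular order) into parts that each pairwise non-crossing has at least r parts; and there exists a partition of the edge set of O_r into exactly r parts, each spanning a star forest (consisting of two vertex-disjoint stars with r − 1 edges each) and each containing no two crossing edges. Hence the star arboricity book thickness of O_r equals r. -/

import Mathlib

/-- A simple graph is a *star forest* iff each of its connected components is a
star `K_{1,m}` (`m ≥ 0`); equivalently it is acyclic and contains no path with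
three edges, which is captured by this local condition on walks of length 3. -/
def IsStarForest {V : Type*} (G : SimpleGraph V) : Prop :=
  ∀ a b c d : V, G.Adj a b → G.Adj b c → G.Adj c d → a = c ∨ b = d

/-- With `Fin n` placed in this circular order on a circle, `x` lies strictly
inside the open circular arc from `a` to `b` (going counterclockwise). -/
def InOpenArc {n : ℕ} (a b x : Fin n) : Prop :=
  0 < (x - a).val ∧ (x - a).val < (b - a).val

/-- Two chords on the circle points `Fin n` *cross* iff they have four distinct
endpoints and exactly one endpoint of the second chord lies in the open
circular arc from one endpoint of the first chord to the other. -/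
def Cross {n : ℕ} (e f : Sym2 (Fin n)) : Prop :=
  ∃ a b c d : Fin n, e = s(a, b) ∧ f = s(c, d) ∧
    a ≠ b ∧ c ≠ d ∧ a ≠ c ∧ a ≠ d ∧ b ≠ c ∧ b ≠ d ∧
    (InOpenArc a b c ↔ ¬ InOpenArc a b d)

/-- The vertex antipodal to `i` on the circle `Fin (2r)`. -/
def antipode (r : ℕ) (i : Fin (2 * r)) : Fin (2 * r) :=
  ⟨(i.val + r) % (2 * r), Nat.mod_lt _ (Nat.lt_of_le_of_lt (Nat.zero_le _) i.isLt)⟩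

/-- The `r` antipodal edges `{i, i+r}` of `K_{2r}`. -/
def antipodalEdges (r : ℕ) : Set (Sym2 (Fin (2 * r))) :=
  {e | ∃ i : Fin (2 * r), e = s(i, antipode r i)}

/-- A set of edges is a *star* iff all its edges share a common endpoint. -/
def IsStarEdgeSet {V : Type*} (S : Set (Sym2 V)) : Prop :=
  ∃ c : V, ∀ e ∈ S, c ∈ e

/-- Two edge sets are *vertex-disjoint* iff no vertex lies in an edge of both. -/
def VertexDisjoint {V : Type*} (A B : Set (Sym2 V)) : Prop :=
  ∀ e ∈ A, ∀ f ∈ B, ∀ v : V, v ∈ e → v ∉ f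

/-- The octahedron (cocktail party graph) `O_r = K_{2r} − rK_2`: the complete
graph on `Fin (2r)` minus the perfect matching of antipodal edges. -/
def octahedron (r : ℕ) : SimpleGraph (Fin (2 * r)) :=
  (⊤ : SimpleGraph (Fin (2 * r))).deleteEdges (antipodalEdges r)
def StArc {r : ℕ} (a b : Fin (2 * r)) : Prop :=
  (a.val < b.val ∧ b.val < a.val + r) ∨ b.val + r < a.val

def StPart {r : ℕ} (c : Fin (2 * r)) : Set (Sym2 (Fin (2 * r))) :=
  {e | ∃ b, e = s(c, b) ∧ StArc c b}

theorem arc_val {n : ℕ} (a b : Fin n) :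
    (a.val ≤ b.val ∧ (b - a).val = b.val - a.val) ∨
    (b.val < a.val ∧ (b - a).val = b.val + n - a.val) := by
  have ha := a.isLt
  have hb := b.isLt
  rw [Fin.sub_def]
  rcases Nat.lt_or_ge b.val a.val with h | h
  · right
    refine ⟨h, ?_⟩
    show (n - a.val + b.val) % n = _
    rw [Nat.mod_eq_of_lt (by omega)]; omega
  · left
    refine ⟨h, ?_⟩
    show (n - a.val + b.val) % n = _
    rw [show n - a.val + b.val = (b.val - a.val) + n by omega, Nat.add_mod_right,
      Nat.mod_eq_of_lt (by omega)]

theorem antipode_val (r : ℕ) (i : Fin (2 * r)) :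
    (i.val < r ∧ (antipode r i).val = i.val + r) ∨
    (r ≤ i.val ∧ (antipode r i).val = i.val - r) := by
  have hi := i.isLt
  rcases Nat.lt_or_ge i.val r with h | h
  · left
    refine ⟨h, ?_⟩
    show (i.val + r) % (2 * r) = _
    rw [Nat.mod_eq_of_lt (by omega)]
  · right
    refine ⟨h, ?_⟩
    show (i.val + r) % (2 * r) = _
    rw [show i.val + r = (i.val - r) + 2 * r by omega, Nat.add_mod_right,
      Nat.mod_eq_of_lt (by omega)]

theorem oct_mem {r : ℕ} (a b : Fin (2 * r)) :
    s(a, b) ∈ (octahedron r).edgeSet ↔ StArc a b ∨ StArc b a := by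
  have ha := a.isLt
  have hb := b.isLt
  simp only [octahedron, SimpleGraph.mem_edgeSet, SimpleGraph.deleteEdges_adj, SimpleGraph.top_adj,
    antipodalEdges, Set.mem_ofPred_eq, StArc]
  constructor
  · rintro ⟨hne, hn⟩
    have hne' : a.val ≠ b.val := fun h => hne (Fin.ext h)
    have h1 : b.val ≠ (antipode r a).val := fun h => hn ⟨a, by rw [Fin.ext h]⟩
    rcases antipode_val r a with h | h <;> omega
  · intro h
    refine ⟨fun h' => ?_, ?_⟩
    · subst h'; omega
    · rintro ⟨i, hi⟩
      have hv := antipode_val r i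
      rw [Sym2.eq_iff] at hi
      rcases hi with ⟨h1, h2⟩ | ⟨h1, h2⟩ <;> subst h1 <;> rw [h2] at h <;> omega

theorem fin_ne {n : ℕ} {a b : Fin n} (h : a ≠ b) : a.val ≠ b.val := fun h' => h (Fin.ext h')

/-- the edge `{i, i + r - 1}` -/
def nearEnd {r : ℕ} (i : Fin (2 * r)) : Fin (2 * r) :=
  if h : i.val + r - 1 < 2 * r then ⟨i.val + r - 1, h⟩
  else ⟨i.val - r - 1, by have := i.isLt; omega⟩

theorem nearEnd_val {r : ℕ} (i : Fin (2 * r)) :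
    (i.val + r - 1 < 2 * r ∧ (nearEnd i).val = i.val + r - 1) ∨
    (2 * r ≤ i.val + r - 1 ∧ (nearEnd i).val = i.val - r - 1) := by
  unfold nearEnd
  split_ifs with h
  · left; exact ⟨h, rfl⟩
  · right; exact ⟨by omega, rfl⟩

theorem near_cross {r : ℕ} (hr : 4 ≤ r) (i j : Fin (2 * r))
    (h : (i.val < j.val ∧ j.val + 2 ≤ i.val + r) ∨ j.val + r + 2 ≤ i.val) :
    Cross s(i, nearEnd i) s(j, nearEnd j) := by
  have hi := i.isLt
  have hj := j.isLt
  have h1 := nearEnd_val i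
  have h2 := nearEnd_val j
  have e1 := arc_val i j
  have e2 := arc_val i (nearEnd i)
  have e3 := arc_val i (nearEnd j)
  refine ⟨i, nearEnd i, j, nearEnd j, rfl, rfl, ?_, ?_, ?_, ?_, ?_, ?_, ?_⟩
  iterate 6 (intro hh; have := congrArg Fin.val hh; omega)
  unfold InOpenArc
  omega

theorem lower (r : ℕ) (hr : 4 ≤ r) (k : ℕ) (P : Fin k → Set (Sym2 (Fin (2 * r))))
    (h2 : ∀ e ∈ (octahedron r).edgeSet, ∃! i, e ∈ P i)
    (h3 : ∀ i, ∀ e ∈ P i, ∀ f ∈ P i, ¬ Cross e f) : r ≤ k := by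
  have hex : ∀ i : Fin (2 * r), ∃ p, s(i, nearEnd i) ∈ P p := by
    intro i
    refine (h2 _ ?_).exists
    rw [oct_mem]
    have := nearEnd_val i
    have := i.isLt
    unfold StArc
    omega
  choose f hf using hex
  have key : ∀ i j : Fin (2 * r), f i = f j → i.val < j.val →
      i.val + r ≤ j.val + 1 ∧ j.val ≤ i.val + r + 1 := by
    intro i j hij hlt
    by_contra hc
    have hi := hf i
    rw [hij] at hi
    by_cases h : j.val + 2 ≤ i.val + r
    · exact h3 _ _ hi _ (hf j) (near_cross hr i j (by omega))
    · exact h3 _ _ (hf j) _ hi (near_cross hr j i (by omega))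
  have hc : (Finset.univ : Finset (Fin (2 * r))).card ≤ 2 * (Finset.univ : Finset (Fin k)).card := by
    apply Finset.card_le_mul_card_image_of_maps_to (f := f) (fun _ _ => Finset.mem_univ _)
    intro p _
    by_contra hcon
    push Not at hcon
    obtain ⟨a, b, c, ha, hb, hc, hab, hac, hbc⟩ := Finset.two_lt_card_iff.mp hcon
    simp only [Finset.mem_filter, Finset.mem_univ, true_and] at ha hb hc
    have := fin_ne hab
    have := fin_ne hac
    have := fin_ne hbc
    have k1 := key a b (by rw [ha, hb])
    have k2 := key b a (by rw [ha, hb])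
    have k3 := key a c (by rw [ha, hc])
    have k4 := key c a (by rw [ha, hc])
    have k5 := key b c (by rw [hb, hc])
    have k6 := key c b (by rw [hb, hc])
    omega
  simp at hc
  omega

theorem stPart_ncard {r : ℕ} (c : Fin (2 * r)) : (StPart c).ncard = r - 1 := by
  have hc := c.isLt
  let g : Fin (r - 1) → Fin (2 * r) := fun t =>
    if h : c.val + t.val + 1 < 2 * r then ⟨c.val + t.val + 1, h⟩
    else ⟨c.val + t.val + 1 - 2 * r, by have := t.isLt; omega⟩
  have hg : ∀ t, (c.val + t.val + 1 < 2 * r ∧ (g t).val = c.val + t.val + 1) ∨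
      (2 * r ≤ c.val + t.val + 1 ∧ (g t).val = c.val + t.val + 1 - 2 * r) := by
    intro t
    simp only [g]
    split_ifs with h
    · left; exact ⟨h, rfl⟩
    · right; exact ⟨by omega, rfl⟩
  have hR : StPart c = Set.range (fun t => s(c, g t)) := by
    ext e
    simp only [StPart, Set.mem_ofPred_eq, Set.mem_range]
    constructor
    · rintro ⟨b, rfl, hb⟩
      have hb' := b.isLt
      unfold StArc at hb
      by_cases h : c.val < b.val
      · refine ⟨⟨b.val - c.val - 1, by omega⟩, ?_⟩
        have := hg ⟨b.val - c.val - 1, by omega⟩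
        congr 2
        ext
        simp only at this
        omega
      · refine ⟨⟨b.val + 2 * r - c.val - 1, by omega⟩, ?_⟩
        have := hg ⟨b.val + 2 * r - c.val - 1, by omega⟩
        congr 2
        ext
        simp only at this
        omega
    · rintro ⟨t, rfl⟩
      refine ⟨g t, rfl, ?_⟩
      have := hg t
      have := t.isLt
      unfold StArc
      omega
  rw [hR, ← Nat.card_coe_set_eq, Nat.card_range_of_injective]
  · simp
  · intro t u htu
    have h : g t = g u := Sym2.congr_right.mp htu
    have h := congrArg Fin.val h
    have := hg t
    have := hg u
    have := t.isLt
    have := u.isLt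
    ext
    omega

def lo {r : ℕ} (i : Fin r) : Fin (2 * r) := ⟨i.val, by have := i.isLt; omega⟩
def hi {r : ℕ} (i : Fin r) : Fin (2 * r) := ⟨i.val + r, by have := i.isLt; omega⟩

theorem mem_part {r : ℕ} (i : Fin r) (a b : Fin (2 * r)) :
    s(a, b) ∈ StPart (lo i) ∪ StPart (hi i) ↔
      ((a.val = i.val ∨ a.val = i.val + r) ∧ StArc a b) ∨
      ((b.val = i.val ∨ b.val = i.val + r) ∧ StArc b a) := by
  simp only [Set.mem_union, StPart, Set.mem_ofPred_eq]
  constructor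
  · rintro (⟨x, hx, h⟩ | ⟨x, hx, h⟩) <;> rw [Sym2.eq_iff] at hx <;>
      rcases hx with ⟨rfl, rfl⟩ | ⟨rfl, rfl⟩ <;> first | (left; exact ⟨Or.inl rfl, h⟩) | (left; exact ⟨Or.inr rfl, h⟩) | (right; exact ⟨Or.inl rfl, h⟩) | (right; exact ⟨Or.inr rfl, h⟩)
  · have e1 : ∀ x : Fin (2 * r), x.val = i.val → x = lo i := fun x h => Fin.ext h
    have e2 : ∀ x : Fin (2 * r), x.val = i.val + r → x = hi i := fun x h => Fin.ext h
    rintro (⟨h | h, hs⟩ | ⟨h | h, hs⟩)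
    · left; rw [← e1 _ h]; exact ⟨b, rfl, hs⟩
    · right; rw [← e2 _ h]; exact ⟨b, rfl, hs⟩
    · left; rw [← e1 _ h]; exact ⟨a, Sym2.eq_swap, hs⟩
    · right; rw [← e2 _ h]; exact ⟨a, Sym2.eq_swap, hs⟩

theorem part_noncross {r : ℕ} (i : Fin r) (a b c d : Fin (2 * r))
    (h1 : (a.val = i.val ∨ a.val = i.val + r) ∧ StArc a b)
    (h2 : (c.val = i.val ∨ c.val = i.val + r) ∧ StArc c d) (hac : a ≠ c) :
    ¬ InOpenArc a b c ∧ ¬ InOpenArc a b d ∧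
      (InOpenArc b a c ∨ b = c) ∧ (InOpenArc b a d ∨ b = d) := by
  have := arc_val a b
  have := arc_val a c
  have := arc_val a d
  have := arc_val b a
  have := arc_val b c
  have := arc_val b d
  have := a.isLt
  have := b.isLt
  have := c.isLt
  have := d.isLt
  have := fin_ne hac
  simp only [InOpenArc, Fin.ext_iff]
  unfold StArc at h1 h2
  refine ⟨?_, ?_, ?_, ?_⟩ <;> omega

/-- For every `r ≥ 4`, any partition of the edge set of the
octahedron `O_r` (vertices `Fin (2r)` in this circular order) into parts each
pairwise non-crossing has at least `r` parts; and there is a partition of the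
edge set of `O_r` into exactly `r` parts, each spanning a star forest made of
two vertex-disjoint stars with `r − 1` edges each, and each containing no two
crossing edges.  Hence the star arboricity book thickness of `O_r` equals `r`. -/
theorem sabt_of_octahedron (r : ℕ) (hr : 4 ≤ r) :
    (∀ k : ℕ, ∀ P : Fin k → Set (Sym2 (Fin (2 * r))),
      (∀ i, P i ⊆ (octahedron r).edgeSet) →
      (∀ e ∈ (octahedron r).edgeSet, ∃! i, e ∈ P i) →
      (∀ i, ∀ e ∈ P i, ∀ f ∈ P i, ¬ Cross e f) →
      r ≤ k) ∧
    (∃ P : Fin r → Set (Sym2 (Fin (2 * r))),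
      (∀ i, P i ⊆ (octahedron r).edgeSet) ∧
      (∀ e ∈ (octahedron r).edgeSet, ∃! i, e ∈ P i) ∧
      (∀ i, IsStarForest (SimpleGraph.fromEdgeSet (P i))) ∧
      (∀ i, ∃ A B : Set (Sym2 (Fin (2 * r))), P i = A ∪ B ∧
        IsStarEdgeSet A ∧ IsStarEdgeSet B ∧ VertexDisjoint A B ∧
        A.ncard = r - 1 ∧ B.ncard = r - 1) ∧
      (∀ i, ∀ e ∈ P i, ∀ f ∈ P i, ¬ Cross e f)) := by
  refine ⟨fun k P _ h2 h3 => lower r hr k P h2 h3,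
    fun i => StPart (lo i) ∪ StPart (hi i), ?_, ?_, ?_, ?_, ?_⟩
  · intro i e
    induction e with | _ a b => ?_
    rw [mem_part, oct_mem]
    tauto
  · intro e
    induction e with | _ a b => ?_
    rw [oct_mem]
    intro h
    have ha := a.isLt
    have hb := b.isLt
    have key : ∀ x y : Fin (2 * r), StArc x y →
        ∃ i : Fin r, (x.val = i.val ∨ x.val = i.val + r) := by
      intro x y _
      have := x.isLt
      by_cases hx : x.val < r
      · exact ⟨⟨x.val, hx⟩, Or.inl rfl⟩
      · exact ⟨⟨x.val - r, by omega⟩, Or.inr (by simp only; omega)⟩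
    simp only [mem_part]
    apply existsUnique_of_exists_of_unique
    · rcases h with h | h
      · obtain ⟨i, hi⟩ := key _ _ h
        exact ⟨i, Or.inl ⟨hi, h⟩⟩
      · obtain ⟨i, hi⟩ := key _ _ h
        exact ⟨i, Or.inr ⟨hi, h⟩⟩
    · intro i j hi hj
      have := i.isLt
      have := j.isLt
      unfold StArc at hi hj
      ext
      omega
  · intro i a b c d hab hbc hcd
    rw [SimpleGraph.fromEdgeSet_adj, mem_part] at hab hbc hcd
    have hab := hab.1
    have hbc := hbc.1
    have hcd := hcd.1
    have := i.isLt
    have := a.isLt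
    have := b.isLt
    have := c.isLt
    have := d.isLt
    unfold StArc at hab hbc hcd
    rw [Fin.ext_iff, Fin.ext_iff]
    rcases hab with hab | hab
    · left
      omega
    · right
      omega
  · intro i
    refine ⟨StPart (lo i), StPart (hi i), rfl, ⟨lo i, ?_⟩, ⟨hi i, ?_⟩, ?_,
      stPart_ncard _, stPart_ncard _⟩
    · rintro e ⟨b, rfl, _⟩
      simp
    · rintro e ⟨b, rfl, _⟩
      simp
    · rintro e ⟨b, rfl, hb⟩ f ⟨d, rfl, hd⟩ v hv hv'
      rw [Sym2.mem_iff] at hv hv'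
      have := i.isLt
      have := b.isLt
      have := d.isLt
      simp only [StArc, lo, hi, Fin.ext_iff] at hb hd hv hv'
      omega
  · rintro i e he f hf ⟨a, b, c, d, rfl, rfl, hab, hcd, hac, had, hbc, hbd, h⟩
    rw [mem_part] at he hf
    rcases he with he | he <;> rcases hf with hf | hf
    · have := part_noncross i _ _ _ _ he hf hac
      tauto
    · have := part_noncross i _ _ _ _ he hf had
      tauto
    · have := part_noncross i _ _ _ _ he hf hbc
      tauto
    · have := part_noncross i _ _ _ _ he hf hbd
      tauto
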